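/- arXiv:2310.09022 — 8 statements merged into one kernel-verified Lean document; each statement's English description precedes it below -/
import Mathlib

section
/- Let m, k ∈ ℝ and s > 0, and let γ be the Gaussian probability measure on ℝ with mean m and variance s². Then ∫ max(k − x, 0) dγ(x) = (k − m)·Φ((k − m)/s) + s·φ((k − m)/s), where Φ(y) = ∫_{−∞}^y φ(u) du is the standard normal cumulative distribution function and φ(y) = (2π)^{−1/2}·exp(−y²/2) is the standard normal density. (This is the Bachelier/normal-model price of the floorlet with strike k.) -/
open MeasureTheory ProbabilityTheory

/-- The standard normal density `φ(y) = (2π)^{−1/2}·exp(−y²/2)`. -/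
noncomputable def stdNormalPDF (y : ℝ) : ℝ :=
  (2 * Real.pi) ^ (-(1 : ℝ) / 2) * Real.exp (-y ^ 2 / 2)

/-- The standard normal cumulative distribution function `Φ(y) = ∫_{−∞}^y φ(u) du`. -/
noncomputable def stdNormalCDF (y : ℝ) : ℝ := ∫ u in Set.Iic y, stdNormalPDF u

lemma stdNormalPDF_eq_gaussianPDFReal : stdNormalPDF = gaussianPDFReal 0 1 := by
  ext y
  rw [stdNormalPDF, gaussianPDFReal_def, neg_div, Real.rpow_neg (by positivity),
    Real.sqrt_eq_rpow]
  simp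

lemma integrable_stdNormalPDF : Integrable stdNormalPDF := by
  rw [stdNormalPDF_eq_gaussianPDFReal]
  exact integrable_gaussianPDFReal 0 1

lemma integrable_mul_stdNormalPDF : Integrable fun y ↦ y * stdNormalPDF y := by
  convert (integrable_mul_exp_neg_mul_sq (b := 1 / 2) (by norm_num)).const_mul
    ((2 * Real.pi) ^ (-(1 : ℝ) / 2)) using 2 with y
  rw [stdNormalPDF, show -y ^ 2 / 2 = -(1 / 2) * y ^ 2 by ring]
  ring

lemma hasDerivAt_stdNormalPDF (y : ℝ) : HasDerivAt stdNormalPDF (-(y * stdNormalPDF y)) y := by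
  have h : HasDerivAt (fun x : ℝ ↦ -x ^ 2 / 2) (-y) y :=
    ((hasDerivAt_pow 2 y).neg.div_const 2).congr_deriv (by simp; ring)
  exact (h.exp.const_mul ((2 * Real.pi) ^ (-(1 : ℝ) / 2))).congr_deriv (by
    rw [stdNormalPDF]
    ring)

lemma setIntegral_Iic_mul_stdNormalPDF (d : ℝ) :
    ∫ y in Set.Iic d, y * stdNormalPDF y = -stdNormalPDF d := by
  have hlim := tendsto_zero_of_hasDerivAt_of_integrableOn_Iic (a := d)
    (fun y _ ↦ hasDerivAt_stdNormalPDF y) integrable_mul_stdNormalPDF.neg.integrableOn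
    integrable_stdNormalPDF.integrableOn
  have h := integral_Iic_of_hasDerivAt_of_tendsto' (a := d)
    (fun y _ ↦ hasDerivAt_stdNormalPDF y) integrable_mul_stdNormalPDF.neg.integrableOn hlim
  rw [integral_neg] at h
  linarith

lemma integral_max_sub_zero_stdGaussian (d : ℝ) :
    ∫ y, max (d - y) 0 ∂(gaussianReal 0 1) = d * stdNormalCDF d + stdNormalPDF d := by
  have hind : (fun y ↦ gaussianPDFReal 0 1 y • max (d - y) 0) =
      (Set.Iic d).indicator fun y ↦ d * stdNormalPDF y - y * stdNormalPDF y := by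
    ext y
    rw [← stdNormalPDF_eq_gaussianPDFReal, smul_eq_mul]
    by_cases hy : y ≤ d
    · rw [Set.indicator_of_mem (Set.mem_Iic.2 hy), max_eq_left (sub_nonneg.2 hy)]
      ring
    · rw [Set.indicator_of_notMem (by simpa using hy),
        max_eq_right (by linarith [not_le.1 hy]), mul_zero]
  rw [integral_gaussianReal_eq_integral_smul one_ne_zero, hind,
    integral_indicator measurableSet_Iic,
    integral_sub (integrable_stdNormalPDF.const_mul d).integrableOn
      integrable_mul_stdNormalPDF.integrableOn,
    integral_const_mul, setIntegral_Iic_mul_stdNormalPDF, sub_neg_eq_add, stdNormalCDF]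

lemma gaussianReal_eq_map_stdGaussian (m s : ℝ) :
    gaussianReal m ⟨s ^ 2, sq_nonneg s⟩ = (gaussianReal 0 1).map fun y ↦ m + s * y := by
  have h : (fun y : ℝ ↦ m + s * y) = (m + ·) ∘ (s * ·) := rfl
  rw [h, ← Measure.map_map (by fun_prop) (by fun_prop), gaussianReal_map_const_mul,
    gaussianReal_map_const_add, mul_zero, zero_add, mul_one]
  rfl

/-- Bachelier/normal-model price of the floorlet with strike `k`:
for the Gaussian measure `γ` with mean `m` and variance `s²`,
`∫ max(k − x, 0) dγ(x) = (k − m)·Φ((k − m)/s) + s·φ((k − m)/s)`. -/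
theorem bachelier_floorlet_price (m k s : ℝ) (hs : 0 < s) :
    ∫ x, max (k - x) 0 ∂(gaussianReal m ⟨s ^ 2, sq_nonneg s⟩)
      = (k - m) * stdNormalCDF ((k - m) / s) + s * stdNormalPDF ((k - m) / s) := by
  rw [gaussianReal_eq_map_stdGaussian, integral_map (by fun_prop) (by fun_prop)]
  have h (y : ℝ) : max (k - (m + s * y)) 0 = s * max ((k - m) / s - y) 0 := by
    rw [mul_max_of_nonneg _ _ hs.le, mul_sub, mul_div_cancel₀ _ hs.ne', mul_zero,
      sub_add_eq_sub_sub]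
  simp_rw [h]
  rw [integral_const_mul, integral_max_sub_zero_stdGaussian]
  field_simp
end

section
/- Let μ be a probability measure on ℝ, let h : ℝ → ℝ be twice differentiable with h integrable with respect to μ, h' square-integrable with respect to μ, and |h''(x)| ≤ C for all x ∈ ℝ, and let φ : ℝ → ℝ be measurable with ∫ φ² dμ < ∞. Then for every ε ∈ ℝ the function h is integrable with respect to μ_ε^φ and |∫ h dμ_1^φ − ∫ h dμ − ∫ h'(x)·φ(x) dμ(x)| ≤ (C/2)·∫ φ(x)² dμ(x), where μ_1^φ is the pushforward of μ under x ↦ x + φ(x). -/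
open MeasureTheory

/-- First-order Taylor estimate for a function with second derivative bounded by `C`. -/
theorem abs_sub_sub_deriv_mul_le {h h' h'' : ℝ → ℝ} {C : ℝ}
    (hd : ∀ x, HasDerivAt h (h' x) x) (hd' : ∀ x, HasDerivAt h' (h'' x) x)
    (hbdd : ∀ x, |h'' x| ≤ C) (x y : ℝ) :
    |h (x + y) - h x - h' x * y| ≤ C / 2 * y ^ 2 := by
  have lip (a b : ℝ) : |h' b - h' a| ≤ C * |b - a| :=
    convex_univ.norm_image_sub_le_of_norm_hasDerivWithin_le
      (fun z _ => (hd' z).hasDerivWithinAt) (fun z _ => hbdd z) (Set.mem_univ a) (Set.mem_univ b)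
  have hf (t : ℝ) : HasDerivAt (fun t => h (x + t * y) - h x - h' x * (t * y))
      (h' (x + t * y) * y - h' x * y) t := by
    have hlin : HasDerivAt (fun t : ℝ => t * y) y t := by
      simpa using (hasDerivAt_id t).mul_const y
    exact (((hd (x + t * y)).comp t (hlin.const_add x)).sub_const (h x)).sub
      (hlin.const_mul (h' x))
  have hB (t : ℝ) : HasDerivAt (fun t => C / 2 * y ^ 2 * t ^ 2) (C * y ^ 2 * t) t := by
    refine ((hasDerivAt_pow 2 t).const_mul (C / 2 * y ^ 2)).congr_deriv ?_
    push_cast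
    ring
  have key := image_norm_le_of_norm_deriv_right_le_deriv_boundary (a := 0) (b := 1)
    (fun t _ => (hf t).continuousAt.continuousWithinAt)
    (fun t _ => (hf t).hasDerivWithinAt) (by simp) hB
    (fun t ht => by
      rw [← sub_mul, norm_mul, Real.norm_eq_abs, Real.norm_eq_abs]
      calc |h' (x + t * y) - h' x| * |y| ≤ C * |x + t * y - x| * |y| := by
            gcongr
            exact lip x (x + t * y)
        _ = C * y ^ 2 * t := by
            rw [add_sub_cancel_left, abs_mul, abs_of_nonneg ht.1, ← sq_abs y]
            ring)
    (Set.right_mem_Icc.2 zero_le_one)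
  simpa using key

/-- Taylor estimate for the pushforward `μ_ε^φ = (id + ε·φ)_♯ μ`:
`h` is integrable with respect to every `μ_ε^φ` and
`|∫ h dμ_1^φ − ∫ h dμ − ∫ h'·φ dμ| ≤ (C/2)·∫ φ² dμ`. -/
theorem pushforward_taylor_bound
    (μ : Measure ℝ) [IsProbabilityMeasure μ]
    (h h' h'' : ℝ → ℝ) (C : ℝ)
    (hd : ∀ x, HasDerivAt h (h' x) x)
    (hd' : ∀ x, HasDerivAt h' (h'' x) x)
    (hint : Integrable h μ)
    (hL2 : Integrable (fun x => (h' x) ^ 2) μ)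
    (hbdd : ∀ x, |h'' x| ≤ C)
    (φ : ℝ → ℝ) (hφmeas : Measurable φ)
    (hφ2 : Integrable (fun x => (φ x) ^ 2) μ) :
    (∀ ε : ℝ, Integrable h (μ.map (fun x => x + ε * φ x))) ∧
    |(∫ x, h x ∂(μ.map (fun x => x + φ x))) - (∫ x, h x ∂μ) - ∫ x, h' x * φ x ∂μ|
      ≤ (C / 2) * ∫ x, (φ x) ^ 2 ∂μ := by
  have hc : Continuous h := continuous_iff_continuousAt.2 fun x => (hd x).continuousAt
  have hc' : Continuous h' := continuous_iff_continuousAt.2 fun x => (hd' x).continuousAt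
  have hmul : Integrable (fun x => h' x * φ x) μ :=
    ((memLp_two_iff_integrable_sq hc'.aestronglyMeasurable).2 hL2).integrable_mul
      ((memLp_two_iff_integrable_sq hφmeas.aestronglyMeasurable).2 hφ2)
  have hT (ε : ℝ) : Measurable fun x => x + ε * φ x := by fun_prop
  have hcomp (ε : ℝ) : Integrable (fun x => h (x + ε * φ x)) μ := by
    have hrem : Integrable (fun x => h (x + ε * φ x) - h x - h' x * (ε * φ x)) μ := by
      refine (hφ2.const_mul (C / 2 * ε ^ 2)).mono' ?_ (ae_of_all _ fun x => ?_)
      · have := hc.measurable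
        have := hc'.measurable
        exact Measurable.aestronglyMeasurable (by fun_prop)
      · refine (abs_sub_sub_deriv_mul_le hd hd' hbdd x (ε * φ x)).trans_eq ?_
        ring
    refine ((hrem.add hint).add (hmul.const_mul ε)).congr (ae_of_all _ fun x => ?_)
    simp only [Pi.add_apply]
    ring
  refine ⟨fun ε => (integrable_map_measure hc.aestronglyMeasurable (hT ε).aemeasurable).2
    (hcomp ε), ?_⟩
  have hcomp_one : Integrable (fun x => h (x + φ x)) μ := by simpa using hcomp 1
  have hdiff : Integrable (fun x => h (x + φ x) - h x) μ := hcomp_one.sub hint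
  rw [integral_map (by fun_prop) hc.aestronglyMeasurable, ← integral_sub hcomp_one hint,
    ← integral_sub hdiff hmul, ← integral_const_mul, ← Real.norm_eq_abs]
  exact norm_integral_le_of_norm_le (hφ2.const_mul (C / 2))
    (ae_of_all _ fun x => abs_sub_sub_deriv_mul_le hd hd' hbdd x (φ x))
end

section
/- Let μ be a probability measure on ℝ, let h : ℝ → ℝ be twice differentiable with h integrable with respect to μ, h' square-integrable with respect to μ, and h'' bounded on ℝ, let φ : ℝ → ℝ be measurable with ∫ φ² dμ < ∞, and let g : ℝ → ℝ be differentiable at the point ∫ h dμ. Then the real function ε ↦ g(∫ h dμ_ε^φ) is differentiable at ε = 0 with derivative g'(∫ h dμ) · ∫ h'(x)·φ(x) dμ(x). -/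
open MeasureTheory

/-- Differentiation under the integral sign along the transport `x ↦ x + ε * φ x`. -/
theorem hasDerivAt_integral_comp_add_mul
    (μ : Measure ℝ) (h h' h'' φ : ℝ → ℝ)
    (hd : ∀ x, HasDerivAt h (h' x) x)
    (hd' : ∀ x, HasDerivAt h' (h'' x) x)
    (hint : Integrable h μ)
    (hL2 : MemLp h' 2 μ)
    (hbdd : ∃ C : ℝ, ∀ x, |h'' x| ≤ C)
    (hφmeas : Measurable φ)
    (hφ2 : MemLp φ 2 μ) :
    HasDerivAt (fun ε : ℝ => ∫ x, h (x + ε * φ x) ∂μ) (∫ x, h' x * φ x ∂μ) 0 := by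
  obtain ⟨C, hC⟩ := hbdd
  have hcont : Continuous h := continuous_iff_continuousAt.2 fun x => (hd x).continuousAt
  have hcont' : Continuous h' := continuous_iff_continuousAt.2 fun x => (hd' x).continuousAt
  have hC0 : 0 ≤ C := (abs_nonneg _).trans (hC 0)
  have hlip (x y : ℝ) : |h' y - h' x| ≤ C * |y - x| :=
    convex_univ.norm_image_sub_le_of_norm_hasDerivWithin_le
      (fun z _ => (hd' z).hasDerivWithinAt) (fun z _ => hC z) (Set.mem_univ x) (Set.mem_univ y)
  have key := hasDerivAt_integral_of_dominated_loc_of_deriv_le (μ := μ) (x₀ := (0 : ℝ))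
    (F := fun ε x => h (x + ε * φ x)) (F' := fun ε x => h' (x + ε * φ x) * φ x)
    (bound := fun x => |h' x * φ x| + C * φ x ^ 2)
    (Metric.ball_mem_nhds 0 one_pos)
    (.of_forall fun ε => (hcont.measurable.comp
      (measurable_id.add (hφmeas.const_mul ε))).aestronglyMeasurable)
    (by simpa using hint)
    (((hcont'.measurable.comp (measurable_id.add (hφmeas.const_mul 0))).mul
      hφmeas).aestronglyMeasurable)
    (.of_forall fun x ε hε => ?_)
    ((hL2.integrable_mul hφ2).abs.add (hφ2.integrable_sq.const_mul C))
    (.of_forall fun x ε _ => ?_)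
  · simpa using key.2
  · have hε' : |ε| ≤ 1 := by simpa using (mem_ball_zero_iff.1 hε).le
    have hdiff : |h' (x + ε * φ x) - h' x| ≤ C * |φ x| := by
      refine (hlip x (x + ε * φ x)).trans (mul_le_mul_of_nonneg_left ?_ hC0)
      rw [add_sub_cancel_left, abs_mul]
      exact mul_le_of_le_one_left (abs_nonneg _) hε'
    calc ‖h' (x + ε * φ x) * φ x‖
        = |h' x * φ x + (h' (x + ε * φ x) - h' x) * φ x| := by
          rw [Real.norm_eq_abs]; ring_nf
      _ ≤ |h' x * φ x| + |h' (x + ε * φ x) - h' x| * |φ x| := by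
          rw [← abs_mul]; exact abs_add_le _ _
      _ ≤ |h' x * φ x| + C * |φ x| * |φ x| := by gcongr
      _ = |h' x * φ x| + C * φ x ^ 2 := by rw [← sq_abs (φ x)]; ring
  · have hinner : HasDerivAt (fun ε : ℝ => x + ε * φ x) (φ x) ε := by
      simpa using ((hasDerivAt_id ε).mul_const (φ x)).const_add x
    exact (hd _).comp ε hinner

/-- The map `ε ↦ g(∫ h dμ_ε^φ)`, where `μ_ε^φ = (id + ε·φ)_♯ μ`,
is differentiable at `ε = 0` with derivative `g'(∫ h dμ) · ∫ h'·φ dμ`. -/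
theorem deriv_along_pushforward_curve
    (μ : Measure ℝ) [IsProbabilityMeasure μ]
    (h h' h'' : ℝ → ℝ)
    (hd : ∀ x, HasDerivAt h (h' x) x)
    (hd' : ∀ x, HasDerivAt h' (h'' x) x)
    (hint : Integrable h μ)
    (hL2 : Integrable (fun x => (h' x) ^ 2) μ)
    (hbdd : ∃ C : ℝ, ∀ x, |h'' x| ≤ C)
    (φ : ℝ → ℝ) (hφmeas : Measurable φ)
    (hφ2 : Integrable (fun x => (φ x) ^ 2) μ)
    (g : ℝ → ℝ) (g' : ℝ)
    (hg : HasDerivAt g g' (∫ x, h x ∂μ)) :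
    HasDerivAt (fun ε : ℝ => g (∫ x, h x ∂(μ.map (fun x => x + ε * φ x))))
      (g' * ∫ x, h' x * φ x ∂μ) 0 := by
  have hcont : Continuous h := continuous_iff_continuousAt.2 fun x => (hd x).continuousAt
  have hcont' : Continuous h' := continuous_iff_continuousAt.2 fun x => (hd' x).continuousAt
  have hmap (ε : ℝ) :
      ∫ x, h x ∂(μ.map (fun x => x + ε * φ x)) = ∫ x, h (x + ε * φ x) ∂μ :=
    integral_map (measurable_id.add (hφmeas.const_mul ε)).aemeasurable
      hcont.aestronglyMeasurable
  simp_rw [hmap]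
  refine HasDerivAt.comp (0 : ℝ) (by simpa using hg)
    (hasDerivAt_integral_comp_add_mul μ h h' h'' φ hd hd' hint ?_ hbdd hφmeas ?_)
  · exact (memLp_two_iff_integrable_sq hcont'.aestronglyMeasurable).2 hL2
  · exact (memLp_two_iff_integrable_sq hφmeas.aestronglyMeasurable).2 hφ2
end

section
/- Let μ be a probability measure on ℝ, let h : ℝ → ℝ be twice differentiable with h integrable with respect to μ, h' square-integrable with respect to μ, and h'' bounded on ℝ, and let g : ℝ → ℝ be differentiable at the point ∫ h dμ. Then the intrinsic derivative φ ↦ ∫ g'(∫ h dμ)·h'(x)·φ(x) dμ(x) is a Lions derivative: for every ε > 0 there exists δ > 0 such that for every measurable φ : ℝ → ℝ with ‖φ‖_{L²(μ)} ≤ δ one has |g(∫ h dμ_1^φ) − g(∫ h dμ) − g'(∫ h dμ)·∫ h'(x)·φ(x) dμ(x)| ≤ ε·‖φ‖_{L²(μ)}. -/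
open MeasureTheory

/-- The Cauchy–Schwarz inequality for square-integrable real functions. -/
lemma abs_integral_mul_le_sqrt_mul_sqrt {α : Type*} [MeasurableSpace α] {μ : Measure α}
    {u v : α → ℝ} (hu : MemLp u 2 μ) (hv : MemLp v 2 μ) :
    |∫ x, u x * v x ∂μ| ≤ √(∫ x, u x ^ 2 ∂μ) * √(∫ x, v x ^ 2 ∂μ) := by
  have key := integral_mul_norm_le_Lp_mul_Lq (μ := μ) (f := u) (g := v)
    Real.HolderConjugate.two_two (by simpa using hu) (by simpa using hv)
  simp only [Real.rpow_two, ← Real.sqrt_eq_rpow, Real.norm_eq_abs, sq_abs] at key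
  refine (abs_integral_le_integral_abs).trans ?_
  simpa only [abs_mul] using key

/-- A first-order Taylor estimate: if the derivative of `h'` is bounded by `C`, then the
remainder of the expansion of `h` at `x` is at most `C * t ^ 2`. -/
lemma abs_taylor_remainder_le {h h' h'' : ℝ → ℝ} (hd : ∀ x, HasDerivAt h (h' x) x)
    (hd' : ∀ x, HasDerivAt h' (h'' x) x) {C : ℝ} (hC : ∀ x, |h'' x| ≤ C) (x t : ℝ) :
    |h (x + t) - h x - h' x * t| ≤ C * t ^ 2 := by
  have hC0 : 0 ≤ C := (abs_nonneg _).trans (hC 0)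
  have hlip (a b : ℝ) : |h' b - h' a| ≤ C * |b - a| :=
    convex_univ.norm_image_sub_le_of_norm_hasDerivWithin_le
      (fun y _ => (hd' y).hasDerivWithinAt) (fun y _ => hC y) (Set.mem_univ a) (Set.mem_univ b)
  have hderiv (s : ℝ) :
      HasDerivAt (fun s => h (x + s) - h' x * s) (h' (x + s) - h' x) s := by
    have := ((hd (x + s)).comp_const_add x s).fun_sub ((hasDerivAt_id' s).const_mul (h' x))
    rwa [mul_one] at this
  have hmv := (convex_closedBall (0 : ℝ) |t|).norm_image_sub_le_of_norm_hasDerivWithin_le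
    (x := 0) (y := t) (C := C * |t|) (fun s _ => (hderiv s).hasDerivWithinAt)
    (fun s hs => by
      have hs' : |s| ≤ |t| := by simpa using hs
      have := hlip x (x + s)
      rw [add_sub_cancel_left] at this
      exact this.trans (by gcongr))
    (by simp) (by simp)
  simp only [Real.norm_eq_abs, add_zero, mul_zero, sub_zero] at hmv
  calc |h (x + t) - h x - h' x * t| = |h (x + t) - h' x * t - h x| := by congr 1; ring
    _ ≤ C * |t| * |t| := hmv
    _ = C * t ^ 2 := by rw [mul_assoc, abs_mul_abs_self, sq]

/-- Second-order expansion of `φ ↦ ∫ h(x + φ(x)) dμ(x)` in `L²(μ)`. -/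
lemma abs_integral_map_add_sub_le {μ : Measure ℝ} {h h' h'' : ℝ → ℝ}
    (hd : ∀ x, HasDerivAt h (h' x) x) (hd' : ∀ x, HasDerivAt h' (h'' x) x)
    {C : ℝ} (hC : ∀ x, |h'' x| ≤ C) (hint : Integrable h μ) (hL2 : MemLp h' 2 μ)
    {φ : ℝ → ℝ} (hφ : Measurable φ) (hφ2 : MemLp φ 2 μ) :
    |∫ x, h x ∂(μ.map fun x => x + φ x) - ∫ x, h x ∂μ - ∫ x, h' x * φ x ∂μ|
      ≤ C * ∫ x, φ x ^ 2 ∂μ := by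
  have hcont : Continuous h := continuous_iff_continuousAt.2 fun x => (hd x).continuousAt
  have hmeas : Measurable fun x => x + φ x := measurable_id.add hφ
  have hprod : Integrable (fun x => h' x * φ x) μ := hL2.integrable_mul hφ2
  have hsq : Integrable (fun x => C * φ x ^ 2) μ := hφ2.integrable_sq.const_mul C
  have hrem (x : ℝ) := abs_taylor_remainder_le hd hd' hC x (φ x)
  have hR : Integrable (fun x => h (x + φ x) - h x - h' x * φ x) μ :=
    hsq.mono' (((hcont.measurable.comp hmeas).aestronglyMeasurable.sub
      hint.aestronglyMeasurable).sub hprod.aestronglyMeasurable) (.of_forall hrem)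
  have hshift : Integrable (fun x => h (x + φ x)) μ := by
    refine ((hR.add hprod).add hint).congr (.of_forall fun x => ?_)
    simp only [Pi.add_apply]
    ring
  have hdiff : Integrable (fun x => h (x + φ x) - h x) μ := hshift.sub hint
  rw [integral_map hmeas.aemeasurable hcont.aestronglyMeasurable,
    ← integral_sub hshift hint, ← integral_sub hdiff hprod, ← integral_const_mul]
  exact abs_integral_le_integral_abs.trans (integral_mono hR.abs hsq hrem)

/-- The intrinsic derivative `φ ↦ ∫ g'(∫ h dμ)·h'·φ dμ` is a Lions derivative:
for every `ε > 0` there is `δ > 0` such that for every measurable `φ ∈ L²(μ)` with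
`‖φ‖_{L²(μ)} ≤ δ`,
`|g(∫ h dμ_1^φ) − g(∫ h dμ) − g'(∫ h dμ)·∫ h'·φ dμ| ≤ ε·‖φ‖_{L²(μ)}`. -/
theorem intrinsic_derivative_is_lions_derivative
    (μ : Measure ℝ) [IsProbabilityMeasure μ]
    (h h' h'' : ℝ → ℝ)
    (hd : ∀ x, HasDerivAt h (h' x) x)
    (hd' : ∀ x, HasDerivAt h' (h'' x) x)
    (hint : Integrable h μ)
    (hL2 : Integrable (fun x => (h' x) ^ 2) μ)
    (hbdd : ∃ C : ℝ, ∀ x, |h'' x| ≤ C)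
    (g : ℝ → ℝ) (g' : ℝ)
    (hg : HasDerivAt g g' (∫ x, h x ∂μ)) :
    ∀ ε : ℝ, 0 < ε → ∃ δ : ℝ, 0 < δ ∧
      ∀ φ : ℝ → ℝ, Measurable φ → Integrable (fun x => (φ x) ^ 2) μ →
        Real.sqrt (∫ x, (φ x) ^ 2 ∂μ) ≤ δ →
        |g (∫ x, h x ∂(μ.map (fun x => x + φ x))) - g (∫ x, h x ∂μ)
            - g' * ∫ x, h' x * φ x ∂μ|
          ≤ ε * Real.sqrt (∫ x, (φ x) ^ 2 ∂μ) := by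
  intro ε hε
  obtain ⟨C, hC⟩ := hbdd
  have hC0 : 0 ≤ C := (abs_nonneg _).trans (hC 0)
  have hcont' : Continuous h' := continuous_iff_continuousAt.2 fun x => (hd' x).continuousAt
  have hL2' : MemLp h' 2 μ := (memLp_two_iff_integrable_sq hcont'.aestronglyMeasurable).2 hL2
  set A := √(∫ x, h' x ^ 2 ∂μ)
  set m := ∫ x, h x ∂μ
  have hA : 0 ≤ A := Real.sqrt_nonneg _
  have hK : 0 < A + C + 1 := by positivity
  have hc : 0 < ε / (2 * (A + C + 1)) := by positivity
  obtain ⟨η, hη, hgη⟩ := Metric.eventually_nhds_iff.1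
    ((hasDerivAt_iff_isLittleO.1 hg).bound hc)
  have hL : 0 < |g'| * C + 1 := by positivity
  refine ⟨min 1 (min (η / (2 * (A + C + 1))) (ε / (2 * (|g'| * C + 1)))), by positivity, ?_⟩
  intro φ hφ hφ2 hs
  have hφ2' : MemLp φ 2 μ := (memLp_two_iff_integrable_sq hφ.aestronglyMeasurable).2 hφ2
  have hexp := abs_integral_map_add_sub_le hd hd' hC hint hL2' hφ hφ2'
  have hcs := abs_integral_mul_le_sqrt_mul_sqrt hL2' hφ2'
  rw [← Real.sq_sqrt (integral_nonneg fun x => sq_nonneg (φ x))] at hexp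
  set s := √(∫ x, φ x ^ 2 ∂μ)
  set M := ∫ x, h x ∂(μ.map fun x => x + φ x)
  set I := ∫ x, h' x * φ x ∂μ
  have hs0 : 0 ≤ s := Real.sqrt_nonneg _
  obtain ⟨hs1, hs2, hs3⟩ : s ≤ 1 ∧ s ≤ η / (2 * (A + C + 1)) ∧ s ≤ ε / (2 * (|g'| * C + 1)) := by
    simpa only [le_min_iff] using hs
  rw [le_div_iff₀ (by positivity)] at hs2 hs3
  have hD : |M - m| ≤ (A + C + 1) * s := by
    have htri : |M - m| ≤ |M - m - I| + |I| := by simpa using abs_add_le (M - m - I) I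
    nlinarith [mul_nonneg hC0 (mul_nonneg hs0 (sub_nonneg.2 hs1))]
  have hgM : |g M - g m - (M - m) * g'| ≤ ε / (2 * (A + C + 1)) * |M - m| := by
    refine hgη (y := M) ?_
    rw [Real.dist_eq]
    linarith
  have hfirst : ε / (2 * (A + C + 1)) * |M - m| ≤ ε / 2 * s :=
    calc _ ≤ ε / (2 * (A + C + 1)) * ((A + C + 1) * s) := by gcongr
      _ = ε / 2 * s := by field_simp
  have hsecond : |g' * (M - m - I)| ≤ ε / 2 * s := by
    rw [abs_mul]
    calc |g'| * |M - m - I| ≤ |g'| * (C * s ^ 2) := by gcongr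
      _ = (|g'| * C * s) * s := by ring
      _ ≤ ε / 2 * s := by
        gcongr
        linarith
  calc |g M - g m - g' * I| = |(g M - g m - (M - m) * g') + g' * (M - m - I)| := by
        congr 1; ring
    _ ≤ |g M - g m - (M - m) * g'| + |g' * (M - m - I)| := abs_add_le _ _
    _ ≤ ε * s := by linarith
end

section
/- Let μ be a probability measure on ℝ and l ≥ 1 an integer. For k = 1,…,l let h_k : ℝ → ℝ be twice differentiable with h_k integrable with respect to μ, h_k' square-integrable with respect to μ, and h_k'' bounded on ℝ; let φ : ℝ → ℝ be measurable with ∫ φ² dμ < ∞, and let g : ℝ^l → ℝ be differentiable at the point (∫ h_1 dμ, …, ∫ h_l dμ). Then the real function ε ↦ g(∫ h_1 dμ_ε^φ, …, ∫ h_l dμ_ε^φ) is differentiable at ε = 0 with derivative Σ_{k=1}^l ∂_k g(∫ h_1 dμ, …, ∫ h_l dμ) · ∫ h_k'(x)·φ(x) dμ(x). -/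
open MeasureTheory

/-- Differentiation under the integral sign along the curve of measures `ε ↦ μ_ε^φ`. -/
theorem hasDerivAt_integral_map_add_mul
    (μ : Measure ℝ) {f f' f'' φ : ℝ → ℝ} {C : ℝ}
    (hd : ∀ x, HasDerivAt f (f' x) x) (hd' : ∀ x, HasDerivAt f' (f'' x) x)
    (hint : Integrable f μ) (hL2 : Integrable (fun x => f' x ^ 2) μ)
    (hC : ∀ x, |f'' x| ≤ C) (hφmeas : Measurable φ)
    (hφ2 : Integrable (fun x => φ x ^ 2) μ) :
    HasDerivAt (fun ε : ℝ => ∫ x, f x ∂(μ.map (fun x => x + ε * φ x)))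
      (∫ x, f' x * φ x ∂μ) 0 := by
  have hf : Continuous f := continuous_iff_continuousAt.2 fun x => (hd x).continuousAt
  have hf' : Continuous f' := continuous_iff_continuousAt.2 fun x => (hd' x).continuousAt
  have hmap : ∀ ε : ℝ, ∫ x, f x ∂(μ.map (fun x => x + ε * φ x)) =
      ∫ x, f (x + ε * φ x) ∂μ := fun ε =>
    integral_map (by fun_prop) hf.aestronglyMeasurable
  have hlip : ∀ x y, |f' y - f' x| ≤ C * |y - x| := fun x y =>
    convex_univ.norm_image_sub_le_of_norm_hasDerivWithin_le
      (fun z _ => (hd' z).hasDerivWithinAt) (fun z _ => hC z) (Set.mem_univ x) (Set.mem_univ y)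
  have hC0 : 0 ≤ C := (abs_nonneg _).trans (hC 0)
  simp_rw [hmap]
  have key := hasDerivAt_integral_of_dominated_loc_of_deriv_le (μ := μ) (x₀ := (0 : ℝ))
    (s := Metric.ball 0 1)
    (F := fun ε x => f (x + ε * φ x)) (F' := fun ε x => f' (x + ε * φ x) * φ x)
    (bound := fun x => f' x ^ 2 + (1 + C) * φ x ^ 2)
    (Metric.ball_mem_nhds 0 one_pos)
    (.of_forall fun ε => (hf.measurable.comp (by fun_prop)).aestronglyMeasurable)
    (by simpa using hint)
    (((hf'.measurable.comp (by fun_prop)).mul hφmeas).aestronglyMeasurable)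
    (.of_forall fun x ε hε => ?_)
    (hL2.add (hφ2.const_mul _))
    (.of_forall fun x ε _ => ?_)
  · simpa using key.2
  · have hε1 : |ε| ≤ 1 := by simpa using (Metric.mem_ball.1 hε).le
    have h1 : |f' (x + ε * φ x)| ≤ |f' x| + C * |φ x| := by
      have h2 := hlip x (x + ε * φ x)
      have h3 : C * |x + ε * φ x - x| ≤ C * |φ x| := by
        rw [add_sub_cancel_left, abs_mul]
        gcongr
        exact mul_le_of_le_one_left (abs_nonneg _) hε1
      linarith [abs_sub_abs_le_abs_sub (f' (x + ε * φ x)) (f' x)]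
    rw [Real.norm_eq_abs, abs_mul]
    calc |f' (x + ε * φ x)| * |φ x| ≤ (|f' x| + C * |φ x|) * |φ x| := by gcongr
      _ ≤ |f' x| ^ 2 + (1 + C) * |φ x| ^ 2 := by
        nlinarith [sq_nonneg (|f' x| - |φ x|), sq_nonneg |f' x|, sq_nonneg |φ x|]
      _ = f' x ^ 2 + (1 + C) * φ x ^ 2 := by simp only [sq_abs]
  · have hlin : HasDerivAt (fun ε : ℝ => x + ε * φ x) (φ x) ε := by
      simpa using ((hasDerivAt_id ε).mul_const (φ x)).const_add x
    exact (hd _).comp ε hlin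

/-- Multivariate chain rule along the pushforward curve: the map
`ε ↦ g(∫ h₁ dμ_ε^φ, …, ∫ h_l dμ_ε^φ)` is differentiable at `ε = 0` with derivative
`Σ_k ∂_k g(∫ h₁ dμ, …, ∫ h_l dμ) · ∫ h_k'·φ dμ`. -/
theorem deriv_along_pushforward_curve_multi
    (μ : Measure ℝ) [IsProbabilityMeasure μ]
    (l : ℕ) (hl : 1 ≤ l)
    (h h' h'' : Fin l → ℝ → ℝ)
    (hd : ∀ k x, HasDerivAt (h k) (h' k x) x)
    (hd' : ∀ k x, HasDerivAt (h' k) (h'' k x) x)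
    (hint : ∀ k, Integrable (h k) μ)
    (hL2 : ∀ k, Integrable (fun x => (h' k x) ^ 2) μ)
    (hbdd : ∀ k, ∃ C : ℝ, ∀ x, |h'' k x| ≤ C)
    (φ : ℝ → ℝ) (hφmeas : Measurable φ)
    (hφ2 : Integrable (fun x => (φ x) ^ 2) μ)
    (g : (Fin l → ℝ) → ℝ) (G : (Fin l → ℝ) →L[ℝ] ℝ)
    (hg : HasFDerivAt g G (fun k => ∫ x, h k x ∂μ)) :
    HasDerivAt
      (fun ε : ℝ => g (fun k => ∫ x, h k x ∂(μ.map (fun x => x + ε * φ x))))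
      (∑ k : Fin l, G (Pi.single k 1) * ∫ x, h' k x * φ x ∂μ) 0 := by
  have hcurve : HasDerivAt
      (fun ε : ℝ => fun k => ∫ x, h k x ∂(μ.map (fun x => x + ε * φ x)))
      (fun k => ∫ x, h' k x * φ x ∂μ) 0 :=
    hasDerivAt_pi.2 fun k => by
      obtain ⟨C, hC⟩ := hbdd k
      exact hasDerivAt_integral_map_add_mul μ (hd k) (hd' k) (hint k) (hL2 k) hC hφmeas hφ2
  have hG : G (fun k => ∫ x, h' k x * φ x ∂μ) =
      ∑ k : Fin l, G (Pi.single k 1) * ∫ x, h' k x * φ x ∂μ := by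
    conv_lhs => rw [pi_eq_sum_univ' (fun k => ∫ x, h' k x * φ x ∂μ)]
    simp [mul_comm]
  rw [← hG]
  refine HasFDerivAt.comp_hasDerivAt (0 : ℝ) ?_ hcurve
  simpa using hg
end

section
/- Let μ be a probability measure on ℝ with ∫ x² dμ(x) < ∞, let m = ∫ x dμ(x) and v = Var(μ), let φ : ℝ → ℝ be measurable with ∫ φ² dμ < ∞, and let λ : ℝ → ℝ be differentiable at v. Then the real function ε ↦ λ(Var(μ_ε^φ)) is differentiable at ε = 0 with derivative λ'(v) · ∫ (2x − 2m)·φ(x) dμ(x). (This identifies the directional Lions derivative of the variance-dependent volatility σ(μ) = λ(Var(μ)) as D^Lσ(μ)(x) = λ'(v)·(2x − 2m).) -/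
open MeasureTheory

/-- The variance `Var(ν) = ∫ x² dν − (∫ x dν)²` of a measure `ν` on `ℝ`
with finite second moment. -/
noncomputable def mVar (ν : Measure ℝ) : ℝ := (∫ x, x ^ 2 ∂ν) - (∫ x, x ∂ν) ^ 2

/-- The variance of the pushforward of `μ` under `x ↦ x + ε * φ x` is a quadratic polynomial
in `ε`. -/
theorem mVar_map_add_mul (μ : Measure ℝ) (φ : ℝ → ℝ) (hφmeas : Measurable φ)
    (hx : Integrable (fun x => x) μ) (hx2 : Integrable (fun x => x ^ 2) μ)
    (hφ : Integrable φ μ) (hφ2 : Integrable (fun x => (φ x) ^ 2) μ)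
    (hxφ : Integrable (fun x => x * φ x) μ) (ε : ℝ) :
    mVar (μ.map (fun x => x + ε * φ x)) =
      ((∫ x, x ^ 2 ∂μ) + 2 * ε * (∫ x, x * φ x ∂μ) + ε ^ 2 * ∫ x, (φ x) ^ 2 ∂μ)
        - ((∫ x, x ∂μ) + ε * ∫ x, φ x ∂μ) ^ 2 := by
  have hmap : AEMeasurable (fun x => x + ε * φ x) μ := by fun_prop
  have hsq : ∀ x, (x + ε * φ x) ^ 2 = x ^ 2 + 2 * ε * (x * φ x) + ε ^ 2 * (φ x) ^ 2 := by
    intro x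
    ring
  unfold mVar
  rw [integral_map hmap (by fun_prop), integral_map hmap (by fun_prop)]
  simp_rw [hsq]
  have hadd : Integrable (fun x => x ^ 2 + 2 * ε * (x * φ x)) μ := hx2.add (hxφ.const_mul _)
  rw [integral_add hadd (hφ2.const_mul _), integral_add hx2 (hxφ.const_mul _),
    integral_add hx (hφ.const_mul _)]
  simp only [integral_const_mul]

/-- Directional Lions derivative of the variance-dependent volatility
`σ(μ) = λ(Var(μ))`: the map `ε ↦ λ(Var(μ_ε^φ))` is differentiable at `ε = 0`
with derivative `λ'(v)·∫(2x − 2m)·φ dμ`, identifying `D^Lσ(μ)(x) = λ'(v)·(2x − 2m)`. -/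
theorem lions_derivative_of_variance_volatility
    (μ : Measure ℝ) [IsProbabilityMeasure μ]
    (hμ2 : Integrable (fun x => x ^ 2) μ)
    (m v : ℝ) (hm : m = ∫ x, x ∂μ) (hv : v = mVar μ)
    (φ : ℝ → ℝ) (hφmeas : Measurable φ)
    (hφ2 : Integrable (fun x => (φ x) ^ 2) μ)
    (lam : ℝ → ℝ) (lam' : ℝ)
    (hlam : HasDerivAt lam lam' v) :
    HasDerivAt (fun ε : ℝ => lam (mVar (μ.map (fun x => x + ε * φ x))))
      (lam' * ∫ x, (2 * x - 2 * m) * φ x ∂μ) 0 := by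
  have hx : MemLp (fun x : ℝ => x) 2 μ :=
    (memLp_two_iff_integrable_sq measurable_id.aestronglyMeasurable).2 hμ2
  have hφ : MemLp φ 2 μ := (memLp_two_iff_integrable_sq hφmeas.aestronglyMeasurable).2 hφ2
  have hx1 : Integrable (fun x : ℝ => x) μ := hx.integrable one_le_two
  have hφ1 : Integrable φ μ := hφ.integrable one_le_two
  have hxφ : Integrable (fun x => x * φ x) μ := hx.integrable_mul hφ
  have hvar := mVar_map_add_mul μ φ hφmeas hx1 hμ2 hφ1 hφ2 hxφ
  have hint : ∫ x, (2 * x - 2 * m) * φ x ∂μ = 2 * (∫ x, x * φ x ∂μ) - 2 * m * ∫ x, φ x ∂μ := by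
    rw [← integral_const_mul, ← integral_const_mul,
      ← integral_sub (hxφ.const_mul _) (hφ1.const_mul _)]
    congr 1 with x
    ring
  have hderiv : HasDerivAt (fun ε : ℝ => mVar (μ.map (fun x => x + ε * φ x)))
      (∫ x, (2 * x - 2 * m) * φ x ∂μ) 0 := by
    simp_rw [hvar, hint, ← hm]
    have hid := hasDerivAt_id' (0 : ℝ)
    refine HasDerivAt.congr_deriv
      (((((hid.const_mul 2).mul_const (∫ x, x * φ x ∂μ)).const_add (∫ x, x ^ 2 ∂μ)).add
        ((hid.pow 2).mul_const (∫ x, (φ x) ^ 2 ∂μ))).sub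
        (((hid.mul_const (∫ x, φ x ∂μ)).const_add m).pow 2)) ?_
    norm_num
  have hzero : v = mVar (μ.map (fun x => x + 0 * φ x)) := by
    simp [hv]
  exact HasDerivAt.comp 0 (hzero ▸ hlam) hderiv
end

section
/- Let d ≥ 1 and let λ : ℝ → ℝ^d be continuous on [0,∞) and differentiable at every v > 0, and suppose there is a constant K < ∞ such that v·‖λ'(v)‖² ≤ K for all v > 0, where ‖·‖ is the Euclidean norm on ℝ^d. Then for all v₀, v₁ ≥ 0 one has ‖λ(v₁) − λ(v₀)‖ ≤ 2·√K·|√v₁ − √v₀|. -/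
/-- If `λ : ℝ → ℝ^d` is continuous on `[0,∞)`, differentiable on `(0,∞)`,
and satisfies the pointwise bound `v·‖λ'(v)‖² ≤ K`, then
`‖λ(v₁) − λ(v₀)‖ ≤ 2·√K·|√v₁ − √v₀|` for all `v₀, v₁ ≥ 0`. -/
theorem pointwise_bound_implies_sqrt_lipschitz
    (d : ℕ) (hd : 1 ≤ d)
    (lam lam' : ℝ → EuclideanSpace ℝ (Fin d)) (K : ℝ)
    (hcont : ContinuousOn lam (Set.Ici (0 : ℝ)))
    (hderiv : ∀ v : ℝ, 0 < v → HasDerivAt lam (lam' v) v)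
    (hbdd : ∀ v : ℝ, 0 < v → v * ‖lam' v‖ ^ 2 ≤ K)
    (v₀ v₁ : ℝ) (h0 : 0 ≤ v₀) (h1 : 0 ≤ v₁) :
    ‖lam v₁ - lam v₀‖ ≤ 2 * Real.sqrt K * |Real.sqrt v₁ - Real.sqrt v₀| := by
  have hlip : LipschitzOnWith (Real.toNNReal (2 * √K)) (fun s => lam (s ^ 2)) (Set.Ioi 0) := by
    refine (convex_Ioi (0 : ℝ)).lipschitzOnWith_of_nnnorm_hasDerivWithin_le
      (f' := fun s => (2 * s) • lam' (s ^ 2)) (fun s hs => ?_) (fun s hs => ?_)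
    · have hs : 0 < s := hs
      have hsq : HasDerivAt (fun s : ℝ => s ^ 2) (2 * s) s := by
        simpa using hasDerivAt_pow 2 s
      exact ((hderiv (s ^ 2) (by positivity)).scomp s hsq).hasDerivWithinAt
    · have hs : 0 < s := hs
      have hsqrt : s * ‖lam' (s ^ 2)‖ ≤ √K := by
        apply Real.le_sqrt_of_sq_le
        rw [mul_pow]
        exact hbdd (s ^ 2) (by positivity)
      rw [← NNReal.coe_le_coe, Real.coe_toNNReal _ (by positivity), coe_nnnorm, norm_smul,
        Real.norm_of_nonneg (by positivity), mul_assoc]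
      gcongr
  have hcont_sq : ContinuousOn (fun s : ℝ => lam (s ^ 2)) (closure (Set.Ioi 0)) :=
    hcont.comp (by fun_prop) fun s _ => sq_nonneg s
  have hdist := (hlip.closure hcont_sq).dist_le_mul
    (√v₁) (by simp) (√v₀) (by simp)
  simpa [dist_eq_norm, Real.sq_sqrt, h0, h1] using hdist
end

section
/- Let c > 0 and define the dampening function g : ℝ → ℝ by g(v) = exp(−max(v/c − 1, 0)). Then for all v₀, v₁ ≥ 0 one has |g(v₁) − g(v₀)| ≤ (2/√c)·|√v₁ − √v₀|. (In particular, the mean-field volatility dampening factor v ↦ exp(−max(v/(f·v₀) − 1, 0)), for stretching parameter f ≥ 1 and variance threshold v₀ > 0, satisfies the pointwise Lipschitz condition required by the existence and uniqueness theorem for the mean-field Libor market model, with c = f·v₀.) -/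
theorem monotoneOn_two_mul_add_exp_one_sub_sq :
    MonotoneOn (fun x : ℝ => 2 * x + Real.exp (1 - x ^ 2)) (Set.Ici 1) := by
  have hd (x : ℝ) : HasDerivAt (fun x : ℝ => 2 * x + Real.exp (1 - x ^ 2))
      (2 - 2 * (x * Real.exp (1 - x ^ 2))) x := by
    have h := ((hasDerivAt_id x).const_mul 2).add
      (((hasDerivAt_pow 2 x).const_sub 1).exp)
    refine h.congr_deriv ?_
    simp only [Nat.cast_ofNat]
    ring
  refine monotoneOn_of_deriv_nonneg (convex_Ici 1)
    (fun x _ => (hd x).continuousAt.continuousWithinAt)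
    (fun x _ => (hd x).differentiableAt.differentiableWithinAt) fun x hx => ?_
  rw [interior_Ici, Set.mem_Ioi] at hx
  rw [(hd x).deriv]
  have h1 : x ≤ Real.exp (x ^ 2 - 1) := by
    nlinarith [Real.add_one_le_exp (x ^ 2 - 1)]
  have h2 : Real.exp (x ^ 2 - 1) * Real.exp (1 - x ^ 2) = 1 := by
    rw [← Real.exp_add]
    simp
  nlinarith [mul_le_mul_of_nonneg_right h1 (Real.exp_pos (1 - x ^ 2)).le]

theorem abs_exp_neg_max_sq_sub_one_sub_le {x y : ℝ} (hx : 0 ≤ x) (hy : 0 ≤ y) :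
    |Real.exp (-(max (y ^ 2 - 1) 0)) - Real.exp (-(max (x ^ 2 - 1) 0))| ≤ 2 * |y - x| := by
  wlog hxy : x ≤ y generalizing x y
  · rw [abs_sub_comm, abs_sub_comm y x]
    exact this hy hx (le_of_not_ge hxy)
  have key {z : ℝ} (hz : 0 ≤ z) : -(max (z ^ 2 - 1) 0) = 1 - (max z 1) ^ 2 := by
    rcases le_total z 1 with h | h
    · rw [max_eq_right h, max_eq_right (by nlinarith)]
      ring
    · rw [max_eq_left h, max_eq_left (by nlinarith)]
      ring
  have hle : max x 1 ≤ max y 1 := max_le_max_right 1 hxy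
  have hsub : max y 1 - max x 1 ≤ y - x := by grind
  have hmono := monotoneOn_two_mul_add_exp_one_sub_sq
    (le_max_right x 1) (le_max_right y 1) hle
  have hanti : Real.exp (1 - (max y 1) ^ 2) ≤ Real.exp (1 - (max x 1) ^ 2) := by
    have := le_max_right x 1
    gcongr
  rw [key hx, key hy, abs_of_nonpos (by linarith), abs_of_nonneg (by linarith)]
  simp only at hmono
  linarith

/-- The mean-field volatility dampening factor
`g v = exp(−max(v/c − 1, 0))` satisfies the Lipschitz-type bound
`|g v₁ − g v₀| ≤ (2/√c)·|√v₁ − √v₀|` on `[0,∞)`. -/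
theorem dampening_lipschitz (c : ℝ) (hc : 0 < c) (g : ℝ → ℝ)
    (hg : ∀ v, g v = Real.exp (-(max (v / c - 1) 0)))
    (v₀ v₁ : ℝ) (h0 : 0 ≤ v₀) (h1 : 0 ≤ v₁) :
    |g v₁ - g v₀| ≤ (2 / Real.sqrt c) * |Real.sqrt v₁ - Real.sqrt v₀| := by
  have hs : 0 < Real.sqrt c := Real.sqrt_pos.mpr hc
  have key {v : ℝ} (hv : 0 ≤ v) : v / c = (Real.sqrt v / Real.sqrt c) ^ 2 := by
    rw [div_pow, Real.sq_sqrt hv, Real.sq_sqrt hc.le]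
  rw [hg, hg, key h0, key h1]
  refine (abs_exp_neg_max_sq_sub_one_sub_le (by positivity) (by positivity)).trans_eq ?_
  rw [← sub_div, abs_div, abs_of_pos hs]
  ring
end
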